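/- arXiv:2312.03933 — 2 statements merged into one kernel-verified Lean document; each statement's English description precedes it below -/
import Mathlib

section
/- Suppose K = F₂ and S is a basis of X of orthogonal type. Then two nonzero elements α, β of X* belong to the same orbit of the dual transvection group Tr(S)* if and only if there exists x ∈ X such that ω(x) = α + β and Q_S(x) = α(x). -/
/-- Symplectic transvections as permutations. -/
def transvectionSet {K X : Type*} [Field K] [AddCommGroup X] [Module K X]
    (ω : X →ₗ[K] X →ₗ[K] K) (S : Set X) : Set (Equiv.Perm X) :=
  {f | ∃ s ∈ S, ∃ k : K, k ≠ 0 ∧ ∀ x, f x = x + (k * ω x s) • s}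

/-- The transvection group `Tr(S)`. -/
def transvectionGroup {K X : Type*} [Field K] [AddCommGroup X] [Module K X]
    (ω : X →ₗ[K] X →ₗ[K] K) (S : Set X) : Subgroup (Equiv.Perm X) :=
  Subgroup.closure (transvectionSet ω S)

/-- The graph `G(S)`. -/
def transGraph {K X : Type*} [Field K] [AddCommGroup X] [Module K X]
    (ω : X →ₗ[K] X →ₗ[K] K) (S : Set X) : SimpleGraph S :=
  SimpleGraph.fromRel (fun u v => ω u.1 v.1 ≠ 0)

/-- One t-equivalence step: replace `t ∈ S` by `s + t` where `s, t ∈ S`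
and `ω(s,t) = 1`. -/
def tStep {X : Type*} [AddCommGroup X] [Module (ZMod 2) X]
    (ω : X →ₗ[ZMod 2] X →ₗ[ZMod 2] ZMod 2) (S S' : Set X) : Prop :=
  ∃ s ∈ S, ∃ t ∈ S, s ≠ t ∧ ω s t = 1 ∧ S' = insert (s + t) (S \ {t})

/-- t-equivalence of bases: a sequence of t-equivalence steps. -/
def tEquiv {X : Type*} [AddCommGroup X] [Module (ZMod 2) X]
    (ω : X →ₗ[ZMod 2] X →ₗ[ZMod 2] ZMod 2) : Set X → Set X → Prop :=
  Relation.ReflTransGen (tStep ω)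

/-- The graph `E₆`: a path `0-1-2-3-4` with the extra vertex `5` attached to
the middle vertex `2`. -/
def e6Graph : SimpleGraph (Fin 6) :=
  SimpleGraph.fromRel
    (fun i j => (i, j) ∈ [((0 : Fin 6), (1 : Fin 6)), (1, 2), (2, 3), (3, 4), (2, 5)])

/-- A set `S` is of orthogonal type if it is t-equivalent to a set `S'` such
that `G(S')` is a tree containing `E₆` as an induced subgraph. -/
def IsOrthogonalType {X : Type*} [AddCommGroup X] [Module (ZMod 2) X]
    (ω : X →ₗ[ZMod 2] X →ₗ[ZMod 2] ZMod 2) (S : Set X) : Prop :=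
  ∃ S' : Set X, tEquiv ω S S' ∧ (transGraph ω S').IsTree ∧
    ∃ f : Fin 6 → S', Function.Injective f ∧
      ∀ i j, (transGraph ω S').Adj (f i) (f j) ↔ e6Graph.Adj i j

/-- The alternating form of the `E₆` root lattice modulo 2, in coordinates. -/
def e6Form (c d : Fin 6 → ZMod 2) : ZMod 2 :=
  c 0 * d 1 + c 1 * d 0 + c 1 * d 2 + c 2 * d 1 + c 2 * d 3 + c 3 * d 2 + c 3 * d 4 + c 4 * d 3 +
    c 2 * d 5 + c 5 * d 2

/-- The quadratic form of the `E₆` root lattice modulo 2, in coordinates. -/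
def e6Quad (c : Fin 6 → ZMod 2) : ZMod 2 :=
  c 0 + c 1 + c 2 + c 3 + c 4 + c 5 + (c 0 * c 1 + c 1 * c 2 + c 2 * c 3 + c 3 * c 4 + c 2 * c 5)

/-- The `i`-th simple reflection of `E₆` modulo 2. -/
def e6Move (c : Fin 6 → ZMod 2) (i : Fin 6) : Fin 6 → ZMod 2 :=
  c + Pi.single i (e6Form c (Pi.single i 1))

/-- A rank function which selected words of simple reflections decrease. -/
def e6Rank (c : Fin 6 → ZMod 2) : ℕ :=
  2 * (c 0 + 1).val + 2 * (c 1 + 1).val + (c 2).val + 2 * (c 3 + 1).val + 3 * (c 4 + 1).val +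
    3 * (c 5).val

/-- Words of simple reflections which suffice to decrease `e6Rank`. -/
def e6Words : List (List (Fin 6)) :=
  [[2, 4, 3], [0, 2, 1], [0, 5], [1], [3], [2, 5], [1, 2, 3, 4], [3, 2, 1, 0], [5, 2, 1, 3]]

/-- The nonzero vector of minimal rank with a given value of `e6Quad`. -/
def e6Rep (q : ZMod 2) : Fin 6 → ZMod 2 := ![1, 1, q, 1, 1, 0]

theorem e6Move_e6Move : ∀ c i, e6Move (e6Move c i) i = c := by
  decide +kernel

theorem exists_e6Words_rank_lt : ∀ c, c ≠ 0 → c ≠ e6Rep (e6Quad c) →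
    ∃ w ∈ e6Words, e6Rank (w.foldl e6Move c) < e6Rank c ∧
      w.foldl e6Move c ≠ 0 ∧ e6Quad (w.foldl e6Move c) = e6Quad c := by
  decide +kernel

theorem exists_e6Quad_e6Form : ∀ p q r : ZMod 2, ∃ c d, c ≠ 0 ∧ d ≠ 0 ∧ c + d ≠ 0 ∧
    e6Quad c = p ∧ e6Quad d = q ∧ e6Form c d = r := by
  decide +kernel

/-- Nonzero vectors with the same value of `e6Quad` are related by simple reflections. -/
theorem induction_e6Move {p : (Fin 6 → ZMod 2) → Prop} (hp : ∀ c i, p c → p (e6Move c i))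
    {c d : Fin 6 → ZMod 2} (hc : c ≠ 0) (hd : d ≠ 0) (hcd : e6Quad c = e6Quad d) (h : p c) :
    p d := by
  have hmove : ∀ c i, p (e6Move c i) ↔ p c := fun c i =>
    ⟨fun h => e6Move_e6Move c i ▸ hp _ i h, hp c i⟩
  have hword : ∀ (w : List (Fin 6)) c, p (w.foldl e6Move c) ↔ p c := by
    intro w
    induction w with
    | nil => simp
    | cons i w ih => intro c; rw [List.foldl_cons, ih, hmove]
  have key : ∀ n c, e6Rank c = n → c ≠ 0 → (p c ↔ p (e6Rep (e6Quad c))) := by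
    intro n
    induction n using Nat.strong_induction_on with
    | _ n ih =>
      intro c hn hc
      by_cases hrep : c = e6Rep (e6Quad c)
      · rw [← hrep]
      · obtain ⟨w, -, hlt, hne, hq⟩ := exists_e6Words_rank_lt c hc hrep
        rw [← hword w c, ih _ (hn ▸ hlt) _ rfl hne, hq]
  rw [key _ d rfl hd, ← hcd, ← key _ c rfl hc]
  exact h

/-- The Gram matrix modulo 2 of the simple roots of `E₆`. -/
def e6Gram : Matrix (Fin 6) (Fin 6) (ZMod 2) :=
  !![0, 1, 0, 0, 0, 0; 1, 0, 1, 0, 0, 0; 0, 1, 0, 1, 0, 1; 0, 0, 1, 0, 1, 0; 0, 0, 0, 1, 0, 0;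
    0, 0, 1, 0, 0, 0]

theorem e6Graph_adj_iff (i j : Fin 6) : e6Graph.Adj i j ↔ e6Gram i j ≠ 0 := by
  fin_cases i <;> fin_cases j <;> simp [e6Graph, e6Gram]

section

variable {X : Type*} [AddCommGroup X] [Module (ZMod 2) X]

theorem zmod_two_eq_zero_or_one : ∀ k : ZMod 2, k = 0 ∨ k = 1 := by decide

theorem alternating_swap {ω : X →ₗ[ZMod 2] X →ₗ[ZMod 2] ZMod 2} (halt : ∀ x, ω x x = 0)
    (x y : X) : ω x y = ω y x := by
  have h := halt (x + y)
  simp only [map_add, LinearMap.add_apply, halt, zero_add, add_zero] at h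
  rw [add_comm] at h
  exact CharTwo.add_eq_zero.mp h

/-- A quadratic form over the field with two elements, given by its polarization. -/
structure IsPolarized (ω : X →ₗ[ZMod 2] X →ₗ[ZMod 2] ZMod 2) (Q : X → ZMod 2) : Prop where
  alt : ∀ x, ω x x = 0
  polar : ∀ x y, Q (x + y) + Q x + Q y = ω x y

namespace IsPolarized

variable {ω : X →ₗ[ZMod 2] X →ₗ[ZMod 2] ZMod 2} {Q : X → ZMod 2}

theorem map_add (h : IsPolarized ω Q) (x y : X) : Q (x + y) = Q x + Q y + ω x y := by
  rw [← h.polar x y]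
  linear_combination -(CharTwo.add_self_eq_zero (Q x)) - CharTwo.add_self_eq_zero (Q y)

theorem map_zero (h : IsPolarized ω Q) : Q 0 = 0 := by
  simpa using h.map_add 0 0

theorem map_smul (h : IsPolarized ω Q) (k : ZMod 2) (x : X) : Q (k • x) = k * Q x := by
  obtain rfl | rfl := zmod_two_eq_zero_or_one k <;> simp [h.map_zero]

theorem swap (h : IsPolarized ω Q) (x y : X) : ω x y = ω y x := alternating_swap h.alt x y

/-- On a coset of a hyperbolic plane the quadratic form takes the value `1`. -/
theorem exists_eq_one (h : IsPolarized ω Q) {a b : X} (hab : ω a b = 1) (y : X) :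
    Q y = 1 ∨ Q (y + a) = 1 ∨ Q (y + b) = 1 ∨ Q (y + (a + b)) = 1 := by
  simp only [h.map_add, _root_.map_add, hab]
  generalize Q y = p, Q a = q, Q b = r, ω y a = s, ω y b = t
  revert p q r s t
  decide

end IsPolarized

/-- Six vectors with `Q = 1` whose Gram matrix is that of the simple roots of `E₆` modulo 2. -/
structure IsE6Config (ω : X →ₗ[ZMod 2] X →ₗ[ZMod 2] ZMod 2) (Q : X → ZMod 2)
    (a : Fin 6 → X) : Prop extends IsPolarized ω Q where
  gram : ∀ i j, ω (a i) (a j) = e6Gram i j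
  quad : ∀ i, Q (a i) = 1

/-- The linear combination of the vectors `a i` with given coordinates. -/
abbrev lin (a : Fin 6 → X) : (Fin 6 → ZMod 2) →ₗ[ZMod 2] X :=
  Fintype.linearCombination (ZMod 2) a

namespace IsE6Config

variable {ω : X →ₗ[ZMod 2] X →ₗ[ZMod 2] ZMod 2} {Q : X → ZMod 2} {a : Fin 6 → X}

theorem form_lin (h : IsE6Config ω Q a) (c d : Fin 6 → ZMod 2) :
    ω (lin a c) (lin a d) = e6Form c d := by
  simp [Fintype.linearCombination_apply, Fin.sum_univ_six, h.gram, e6Gram, e6Form]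
  ring

theorem quad_lin (h : IsE6Config ω Q a) (c : Fin 6 → ZMod 2) : Q (lin a c) = e6Quad c := by
  simp [Fintype.linearCombination_apply, Fin.sum_univ_six, h.map_add, h.map_smul, h.gram, h.quad,
    e6Gram, e6Quad]
  ring

/-- The coordinates of the orthogonal projection to the span of an `E₆` configuration. -/
def coords (ω : X →ₗ[ZMod 2] X →ₗ[ZMod 2] ZMod 2) (a : Fin 6 → X) : X →ₗ[ZMod 2] Fin 6 → ZMod 2 :=
  LinearMap.pi ![ω (a 1) + ω (a 5), ω (a 0), ω (a 5), ω (a 4), ω (a 3) + ω (a 5),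
    ω (a 0) + ω (a 2) + ω (a 4)]

theorem form_lin_coords (h : IsE6Config ω Q a) (x : X) (i : Fin 6) :
    ω (a i) (lin a (coords ω a x)) = ω (a i) x := by
  fin_cases i <;>
  simp [coords, Fintype.linearCombination_apply, Fin.sum_univ_six, h.gram, e6Gram] <;> grind

/-- The orthogonal projection to the complement of an `E₆` configuration. -/
def proj (ω : X →ₗ[ZMod 2] X →ₗ[ZMod 2] ZMod 2) (a : Fin 6 → X) : X →ₗ[ZMod 2] X :=
  LinearMap.id + lin a ∘ₗ coords ω a

theorem proj_add_lin (x : X) : proj ω a x + lin a (coords ω a x) = x := by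
  simp [proj, add_assoc, ZModModule.add_self]

theorem form_proj (h : IsE6Config ω Q a) (x : X) (c : Fin 6 → ZMod 2) :
    ω (proj ω a x) (lin a c) = 0 := by
  have h1 : ∀ i, ω (proj ω a x) (a i) = 0 := fun i => by
    rw [h.swap, proj, LinearMap.add_apply, map_add, LinearMap.comp_apply, h.form_lin_coords]
    exact CharTwo.add_self_eq_zero _
  simp [Fintype.linearCombination_apply, h1]

theorem coords_lin (h : IsE6Config ω Q a) (c : Fin 6 → ZMod 2) : coords ω a (lin a c) = c := by
  ext i
  fin_cases i <;>
  simp [coords, Fintype.linearCombination_apply, Fin.sum_univ_six, h.gram, e6Gram] <;> grind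

theorem lin_move (h : IsE6Config ω Q a) (c : Fin 6 → ZMod 2) (i : Fin 6) :
    lin a (e6Move c i) = lin a c + ω (lin a c) (a i) • a i := by
  have : a i = lin a (Pi.single i 1) := by simp [Fintype.linearCombination_apply_single]
  conv_rhs => rw [this, h.form_lin, ← map_smul, ← map_add]
  rw [e6Move]
  congr 2
  ext j
  simp [Pi.single_apply]

theorem lin_eq_zero (h : IsE6Config ω Q a) {c : Fin 6 → ZMod 2}
    (hc : ∀ d, ω (lin a d) (lin a c) = 0) : c = 0 := by
  have hi : ∀ i, ω (a i) (lin a c) = 0 := fun i => by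
    simpa only [Fintype.linearCombination_apply_single, one_smul] using hc (Pi.single i 1)
  rw [← h.coords_lin c]
  ext i
  fin_cases i <;> simp [coords, hi]

theorem nondegenerate (h : IsE6Config ω Q a) :
    LinearMap.BilinForm.Nondegenerate (ω.compl₁₂ (lin a) (lin a)) :=
  ⟨fun _ hc => h.lin_eq_zero fun d => (h.swap _ _).trans (hc d), fun _ hc => h.lin_eq_zero hc⟩

/-- Two linear forms have a hyperbolic plane in their common kernel. -/
theorem exists_hyperbolic (h : IsE6Config ω Q a) (α l : Module.Dual (ZMod 2) X) :
    ∃ u v, α u = 0 ∧ l u = 0 ∧ α v = 0 ∧ l v = 0 ∧ ω u v = 1 := by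
  by_contra! hcon
  let m : (Fin 6 → ZMod 2) →ₗ[ZMod 2] ZMod 2 × ZMod 2 := (α.prod l) ∘ₗ lin a
  have hle : LinearMap.ker m ≤
      LinearMap.BilinForm.orthogonal (ω.compl₁₂ (lin a) (lin a)) (LinearMap.ker m) := by
    intro c hc d hd
    replace hc := Prod.mk_eq_zero.mp (LinearMap.mem_ker.mp hc)
    replace hd := Prod.mk_eq_zero.mp (LinearMap.mem_ker.mp hd)
    exact (zmod_two_eq_zero_or_one _).resolve_right (hcon _ _ hd.1 hd.2 hc.1 hc.2)
  have h1 := Submodule.finrank_mono hle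
  rw [LinearMap.BilinForm.finrank_orthogonal h.nondegenerate] at h1
  have h2 := LinearMap.finrank_range_add_finrank_ker m
  have h3 := Submodule.finrank_le (LinearMap.range m)
  simp only [Module.finrank_prod, Module.finrank_self, Module.finrank_fin_fun] at h1 h2 h3
  omega

/-- A vector on which the quadratic form and a linear form are both `1`, in the kernel of another
linear form. -/
theorem exists_quad_eq_one (h : IsE6Config ω Q a) (α l : Module.Dual (ZMod 2) X) (y : X)
    (hα : α y = 1) (hl : l y = 0) : ∃ y, Q y = 1 ∧ α y = 1 ∧ l y = 0 := by
  obtain ⟨u, v, hu, hu', hv, hv', huv⟩ := h.exists_hyperbolic α l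
  obtain hy | hy | hy | hy := h.exists_eq_one huv y
  · exact ⟨_, hy, hα, hl⟩
  all_goals exact ⟨_, hy, by simp [*], by simp [*]⟩

/-- The predicate that all vectors with `Q = 1` over a vector orthogonal to an `E₆` configuration
lie in `P`. -/
def Good (Q : X → ZMod 2) (P : Set X) (a : Fin 6 → X) (f : X) : Prop :=
  ∀ c, c ≠ 0 → Q (f + lin a c) = 1 → f + lin a c ∈ P

variable {P : Set X}

theorem quad_add_lin (h : IsE6Config ω Q a) {f : X} (hf : ∀ c, ω f (lin a c) = 0)
    (c : Fin 6 → ZMod 2) : Q (f + lin a c) = Q f + e6Quad c := by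
  rw [h.map_add, hf, h.quad_lin, add_zero]

theorem form_add_lin (h : IsE6Config ω Q a) {f g : X} (hf : ∀ c, ω f (lin a c) = 0)
    (hg : ∀ c, ω g (lin a c) = 0) (c d : Fin 6 → ZMod 2) :
    ω (f + lin a c) (g + lin a d) = ω f g + e6Form c d := by
  simp only [map_add, LinearMap.add_apply, hf, h.swap (lin a c) g, hg, h.form_lin, zero_add,
    add_zero]

theorem good_of_mem (h : IsE6Config ω Q a) (haP : ∀ i, a i ∈ P)
    (hP : ∀ u ∈ P, ∀ v ∈ P, ω u v = 1 → u + v ∈ P) {f : X} (hf : ∀ c, ω f (lin a c) = 0)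
    {c : Fin 6 → ZMod 2} (hc : c ≠ 0) (hQ : Q (f + lin a c) = 1) (hmem : f + lin a c ∈ P) :
    Good Q P a f := by
  intro d hd hQd
  rw [h.quad_add_lin hf] at hQ hQd
  refine induction_e6Move (p := fun c => f + lin a c ∈ P) (fun c i hci => ?_) hc hd
    (add_left_cancel (hQ.trans hQd.symm)) hmem
  have hai : ω f (a i) = 0 := by
    simpa [Fintype.linearCombination_apply_single] using hf (Pi.single i 1)
  rw [h.lin_move, ← add_assoc]
  obtain h0 | h1 := zmod_two_eq_zero_or_one (ω (lin a c) (a i))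
  · simpa [h0] using hci
  · rw [h1, one_smul]
    exact hP _ hci _ (haP i) (by simp [hai, h1])

theorem good_add (h : IsE6Config ω Q a) (haP : ∀ i, a i ∈ P)
    (hP : ∀ u ∈ P, ∀ v ∈ P, ω u v = 1 → u + v ∈ P) {f g : X} (hf : ∀ c, ω f (lin a c) = 0)
    (hg : ∀ c, ω g (lin a c) = 0) (hfP : Good Q P a f) (hgP : Good Q P a g) :
    Good Q P a (f + g) := by
  obtain ⟨c, d, hc, hd, hcd, hcQ, hdQ, hform⟩ :=
    exists_e6Quad_e6Form (1 + Q f) (1 + Q g) (1 + ω f g)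
  have hfc : Q (f + lin a c) = 1 := by rw [h.quad_add_lin hf, hcQ]; grind
  have hgd : Q (g + lin a d) = 1 := by rw [h.quad_add_lin hg, hdQ]; grind
  have h1 : ω (f + lin a c) (g + lin a d) = 1 := by rw [h.form_add_lin hf hg, hform]; grind
  have heq : f + g + lin a (c + d) = (f + lin a c) + (g + lin a d) := by rw [map_add]; abel
  have hfg : ∀ c, ω (f + g) (lin a c) = 0 := fun c => by simp [hf, hg]
  refine h.good_of_mem haP hP hfg hcd ?_ ?_
  · rw [heq, h.map_add, hfc, hgd, h1]; decide
  · rw [heq]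
    exact hP _ (hfP c hc hfc) _ (hgP d hd hgd) h1

theorem exists_quad (p : ZMod 2) : ∃ c, c ≠ 0 ∧ e6Quad c = p :=
  let ⟨c, _, hc, _, _, hq, _⟩ := exists_e6Quad_e6Form p 0 0
  ⟨c, hc, hq⟩

theorem good_proj_of_form_eq_one (h : IsE6Config ω Q a) (haP : ∀ i, a i ∈ P)
    (hP : ∀ u ∈ P, ∀ v ∈ P, ω u v = 1 → u + v ∈ P) {s t : X} (hs : s ∈ P) (hQs : Q s = 1)
    (hst : ω t s = 1) (ht : Good Q P a (proj ω a t)) : Good Q P a (proj ω a s) := by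
  have hs' := proj_add_lin (ω := ω) (a := a) s
  by_cases hc : coords ω a s = 0
  · rw [hc, map_zero, add_zero] at hs'
    have horth : ∀ c, ω s (lin a c) = 0 := hs' ▸ h.form_proj s
    have hft := h.form_proj t
    obtain ⟨c, hc, hcQ⟩ := exists_quad (1 + Q (proj ω a t))
    have hQt : Q (proj ω a t + lin a c) = 1 := by rw [h.quad_add_lin hft, hcQ]; grind
    have hts : ω (proj ω a t + lin a c) s = 1 := by
      rw [map_add, LinearMap.add_apply, h.swap (lin a c), horth, add_zero, ← hst]
      conv_rhs => rw [← proj_add_lin (ω := ω) (a := a) t]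
      rw [map_add, LinearMap.add_apply, h.swap (lin a _), horth, add_zero]
    have heq : proj ω a t + s + lin a c = (proj ω a t + lin a c) + s := by abel
    have hgood : Good Q P a (proj ω a t + s) := by
      refine h.good_of_mem haP hP (fun c => by simp [hft, horth]) hc ?_ ?_
      · rw [heq, h.map_add, hQt, hts, hQs]; decide
      · rw [heq]
        exact hP _ (ht c hc hQt) _ hs hts
    have := h.good_add haP hP hft (fun c => by simp [hft, horth]) ht hgood
    rwa [← add_assoc, ZModModule.add_self, zero_add, ← hs'] at this
  · exact h.good_of_mem haP hP (h.form_proj s) hc (by rw [hs', hQs]) (by rwa [hs'])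

/-- A set of vectors which is closed under adding non-orthogonal vectors, and contains the radical
together with a connected spanning set that contains `E₆`, contains all vectors with `Q = 1`. -/
theorem mem_of_quad_eq_one (h : IsE6Config ω Q a) {S : Set X}
    (hspan : Submodule.span (ZMod 2) S = ⊤) (hQS : ∀ s ∈ S, Q s = 1) (haS : ∀ i, a i ∈ S)
    (hconn : (transGraph ω S).Connected) (hSP : S ⊆ P)
    (hP : ∀ u ∈ P, ∀ v ∈ P, ω u v = 1 → u + v ∈ P) (hrad : ∀ x, ω x = 0 → x ∈ P)
    {x : X} (hx : Q x = 1) : x ∈ P := by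
  have haP : ∀ i, a i ∈ P := fun i => hSP (haS i)
  have hzero : Good Q P a 0 := by
    refine h.good_of_mem haP hP (by simp) (c := Pi.single 0 1) (by simp) ?_ ?_
    · simp [Fintype.linearCombination_apply_single, h.quad]
    · simpa [Fintype.linearCombination_apply_single] using haP 0
  have hbase : Good Q P a (proj ω a (a 0)) := by
    have : a 0 = lin a (Pi.single 0 1) := by simp [Fintype.linearCombination_apply_single]
    rw [this, proj, LinearMap.add_apply, LinearMap.comp_apply, h.coords_lin, LinearMap.id_apply,
      ZModModule.add_self]
    exact hzero
  have hwalk : ∀ {s t : S}, (transGraph ω S).Walk s t →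
      Good Q P a (proj ω a t) → Good Q P a (proj ω a s) := by
    intro s t w hbase
    induction w with
    | nil => exact hbase
    | @cons u v _ hadj _ ih =>
      have hvu : ω v u = 1 := by
        refine (zmod_two_eq_zero_or_one _).resolve_left fun h0 => ?_
        rw [transGraph, SimpleGraph.fromRel_adj] at hadj
        obtain h1 | h1 := hadj.2
        · exact h1 (by rw [h.swap]; exact h0)
        · exact h1 h0
      exact h.good_proj_of_form_eq_one haP hP (hSP u.2) (hQS u u.2) hvu (ih hbase)
  have hgoodS : ∀ s : S, Good Q P a (proj ω a s) := fun s =>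
    (hconn.preconnected s ⟨a 0, haS 0⟩).elim fun w => hwalk w hbase
  have hgood : ∀ x, Good Q P a (proj ω a x) := by
    intro x
    have hx : x ∈ Submodule.span (ZMod 2) S := hspan ▸ Submodule.mem_top
    induction hx using Submodule.span_induction with
    | mem x hx => exact hgoodS ⟨x, hx⟩
    | zero => simpa using hzero
    | add x y _ _ hx hy =>
      rw [map_add]
      exact h.good_add haP hP (h.form_proj x) (h.form_proj y) hx hy
    | smul k x _ hx => obtain rfl | rfl := zmod_two_eq_zero_or_one k <;> simpa
  have hx' := proj_add_lin (ω := ω) (a := a) x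
  by_cases hc : coords ω a x = 0
  · rw [hc, map_zero, add_zero] at hx'
    have hxorth : ∀ c, ω x (lin a c) = 0 := hx' ▸ h.form_proj x
    by_cases hrx : ω x = 0
    · exact hrad x hrx
    obtain ⟨z, hz⟩ : ∃ z, ω x z ≠ 0 := by
      by_contra! hcon
      exact hrx (LinearMap.ext hcon)
    set g := proj ω a z with hg
    have hgorth := h.form_proj z
    rw [← hg] at hgorth
    have hxg : ω x g = 1 := by
      refine (zmod_two_eq_zero_or_one _).resolve_left fun h0 => hz ?_
      rw [← proj_add_lin (ω := ω) (a := a) z, map_add, hxorth, add_zero]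
      exact h0
    obtain ⟨c, hc, hcQ⟩ := exists_quad (1 + Q g)
    have hQg : Q (g + lin a c) = 1 := by rw [h.quad_add_lin hgorth, hcQ]; grind
    have hxg' : ω x (g + lin a c) = 1 := by rw [map_add, hxorth, add_zero, hxg]
    have h1 : x + (g + lin a c) ∈ P := by
      have := hgood (x + z) c hc
      rw [map_add, hx', ← hg, add_assoc] at this
      refine this ?_
      rw [h.map_add, hx, hQg, hxg']; decide
    have h2 := hP _ h1 _ (hgood z c hc hQg) (by
      rw [LinearMap.map_add₂, h.alt, add_zero, hxg'])
    rwa [← hg, add_assoc, ZModModule.add_self, add_zero] at h2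
  · have := hgood x _ hc
    rw [hx'] at this
    exact this hx

end IsE6Config

end

section

variable {X : Type*} [AddCommGroup X] [Module (ZMod 2) X]

/-- The vectors whose transvections lie in a group of permutations. -/
def transvectionVectors (ω : X →ₗ[ZMod 2] X →ₗ[ZMod 2] ZMod 2) (G : Subgroup (Equiv.Perm X)) :
    Set X :=
  {s | ∃ g ∈ G, ∀ x, g x = x + ω x s • s}

theorem subset_transvectionVectors {ω : X →ₗ[ZMod 2] X →ₗ[ZMod 2] ZMod 2}
    (halt : ∀ x, ω x x = 0) (S : Set X) :
    S ⊆ transvectionVectors ω (transvectionGroup ω S) := by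
  intro s hs
  have hinv : Function.Involutive fun x => x + ω x s • s := fun x => by
    simp [halt, add_assoc, ZModModule.add_self]
  exact ⟨hinv.toPerm, Subgroup.subset_closure ⟨s, hs, 1, one_ne_zero, fun x => by simp⟩,
    fun x => rfl⟩

theorem add_mem_transvectionVectors {ω : X →ₗ[ZMod 2] X →ₗ[ZMod 2] ZMod 2}
    (halt : ∀ x, ω x x = 0) {G : Subgroup (Equiv.Perm X)} {u v : X}
    (hu : u ∈ transvectionVectors ω G) (hv : v ∈ transvectionVectors ω G) (huv : ω u v = 1) :
    u + v ∈ transvectionVectors ω G := by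
  obtain ⟨g, hg, hgu⟩ := hu
  obtain ⟨k, hk, hkv⟩ := hv
  have hvu : ω v u = 1 := by rw [alternating_swap halt, huv]
  refine ⟨g * k * g, mul_mem (mul_mem hg hk) hg, fun x => ?_⟩
  simp only [Equiv.Perm.mul_apply, hgu, hkv, map_add, map_smul, LinearMap.add_apply,
    LinearMap.smul_apply, halt, huv, hvu, smul_eq_mul, mul_zero, mul_one, add_zero]
  have hx : ω x u + (ω x v + ω x u) = ω x v := by grind
  rw [hx]
  module

theorem mem_transvectionVectors_of_form_eq_zero {ω : X →ₗ[ZMod 2] X →ₗ[ZMod 2] ZMod 2}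
    (halt : ∀ x, ω x x = 0) (G : Subgroup (Equiv.Perm X)) {s : X} (hs : ω s = 0) :
    s ∈ transvectionVectors ω G :=
  ⟨1, one_mem G, fun x => by simp [alternating_swap halt x s, hs]⟩

/-- The properties of a basis which are used below persist under t-equivalence. -/
theorem tEquiv_invariants {ω : X →ₗ[ZMod 2] X →ₗ[ZMod 2] ZMod 2} {Q : X → ZMod 2}
    (h : IsPolarized ω Q) {S S' : Set X} (hspan : Submodule.span (ZMod 2) S = ⊤)
    (hQS : ∀ s ∈ S, Q s = 1) (hS : tEquiv ω S S') :
    Submodule.span (ZMod 2) S' = ⊤ ∧ (∀ s ∈ S', Q s = 1) ∧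
      S' ⊆ transvectionVectors ω (transvectionGroup ω S) := by
  induction hS with
  | refl => exact ⟨hspan, hQS, subset_transvectionVectors h.alt S⟩
  | @tail T _ _ hstep ih =>
    obtain ⟨s, hs, t, ht, hst, hω, rfl⟩ := hstep
    obtain ⟨hsp, hQ, hsub⟩ := ih
    refine ⟨?_, ?_, ?_⟩
    · rw [eq_top_iff, ← hsp, Submodule.span_le]
      intro x hx
      by_cases hxt : x = t
      · have h1 : s + t ∈ Submodule.span (ZMod 2) (insert (s + t) (T \ {t})) :=
          Submodule.subset_span (Set.mem_insert _ _)
        have h2 : s ∈ Submodule.span (ZMod 2) (insert (s + t) (T \ {t})) :=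
          Submodule.subset_span (Set.mem_insert_of_mem _ ⟨hs, hst⟩)
        simpa [hxt] using Submodule.sub_mem _ h1 h2
      · exact Submodule.subset_span (Set.mem_insert_of_mem _ ⟨hx, hxt⟩)
    · rintro x (rfl | hx)
      · rw [h.map_add, hQ s hs, hQ t ht, hω]; decide
      · exact hQ x hx.1
    · rintro x (rfl | hx)
      · exact add_mem_transvectionVectors h.alt (hsub hs) (hsub ht) hω
      · exact hsub hx.1

/-- The dual of a transvection group moves linear forms within the classes of the theorem. -/
theorem exists_of_mem_transvectionGroup {ω : X →ₗ[ZMod 2] X →ₗ[ZMod 2] ZMod 2} {Q : X → ZMod 2}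
    (h : IsPolarized ω Q) {S : Set X} (hQS : ∀ s ∈ S, Q s = 1) {g : Equiv.Perm X}
    (hg : g ∈ transvectionGroup ω S) :
    ∃ e : X ≃ₗ[ZMod 2] X, (∀ x, g x = e x) ∧
      ∀ α : Module.Dual (ZMod 2) X, ∃ x, ω x = α + α ∘ₗ e ∧ Q x = α x := by
  induction hg using Subgroup.closure_induction with
  | mem g hg =>
    obtain ⟨s, hs, k, hk, hgs⟩ := hg
    obtain rfl := (zmod_two_eq_zero_or_one k).resolve_left hk
    have hlin : IsLinearMap (ZMod 2) g :=
      ⟨fun x y => by simp only [hgs, map_add, LinearMap.add_apply]; module,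
        fun k x => by simp only [hgs, map_smul, LinearMap.smul_apply, smul_eq_mul]; module⟩
    refine ⟨LinearEquiv.ofBijective (hlin.mk' g) g.bijective, fun x => rfl, fun α => ?_⟩
    refine ⟨α s • s, ?_, ?_⟩
    · ext y
      change ω (α s • s) y = α y + α (g y)
      simp only [hgs, one_mul, map_smul, LinearMap.smul_apply, map_add, smul_eq_mul, h.swap y s]
      grind
    · rw [h.map_smul, hQS s hs, map_smul, smul_eq_mul]
      obtain h0 | h0 := zmod_two_eq_zero_or_one (α s) <;> simp [h0]
  | one =>
    refine ⟨LinearEquiv.refl _ _, fun x => rfl, fun α => ⟨0, ?_, by simp [h.map_zero]⟩⟩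
    ext y
    simp [CharTwo.add_self_eq_zero]
  | mul g k _ _ hg hk =>
    obtain ⟨e, he, heα⟩ := hg
    obtain ⟨f, hf, hfα⟩ := hk
    refine ⟨f.trans e, fun x => by simp [he, hf], fun α => ?_⟩
    obtain ⟨x, hx, hQx⟩ := heα α
    obtain ⟨y, hy, hQy⟩ := hfα (α ∘ₗ e)
    have hxy := LinearMap.congr_fun hx y
    simp only [LinearMap.add_apply, LinearMap.comp_apply, LinearEquiv.coe_coe] at hxy hQy
    refine ⟨x + y, ?_, ?_⟩
    · ext z
      simp only [map_add, hx, hy, LinearMap.add_apply, LinearMap.comp_apply, LinearEquiv.coe_coe,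
        LinearEquiv.trans_apply]
      grind
    · rw [h.map_add, hQx, hQy, hxy, map_add]
      grind
  | inv g _ hg =>
    obtain ⟨e, he, heα⟩ := hg
    refine ⟨e.symm, fun x => ?_, fun α => ?_⟩
    · rw [Equiv.Perm.inv_eq_iff_eq, he, e.apply_symm_apply]
    · obtain ⟨x, hx, hQx⟩ := heα (α ∘ₗ e.symm)
      have hx' : ω x = α + α ∘ₗ e.symm := by
        rw [hx, add_comm]
        ext y
        simp
      refine ⟨x, hx', hQx.trans ?_⟩
      have := LinearMap.congr_fun hx' x
      rw [h.alt] at this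
      exact (CharTwo.add_eq_zero.mp this.symm).symm

/-- Two linear forms which differ by `ω x` with `Q x = 1` are related by the transvection
along `x`. -/
theorem comp_transvection {ω : X →ₗ[ZMod 2] X →ₗ[ZMod 2] ZMod 2} (halt : ∀ x, ω x x = 0)
    {α β : Module.Dual (ZMod 2) X} {x : X} (hx : ω x = α + β) (hαx : α x = 1) {g : X → X}
    (hg : ∀ y, g y = y + ω y x • x) (y : X) : β y = α (g y) := by
  rw [hg, map_add, map_smul, hαx, alternating_swap halt, hx, LinearMap.add_apply, smul_eq_mul,
    mul_one, ← add_assoc, CharTwo.add_self_eq_zero, zero_add]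

/-- Linear forms in the same class are related by a product of transvections. -/
theorem exists_mem_transvectionGroup {ω : X →ₗ[ZMod 2] X →ₗ[ZMod 2] ZMod 2} {Q : X → ZMod 2}
    {a : Fin 6 → X} (h : IsE6Config ω Q a) {G : Subgroup (Equiv.Perm X)}
    (hG : ∀ x, Q x = 1 → x ∈ transvectionVectors ω G) {α β : Module.Dual (ZMod 2) X}
    (hα : α ≠ 0) (hβ : β ≠ 0) {x : X} (hx : ω x = α + β) (hQ : Q x = α x) :
    ∃ g ∈ G, ∀ y, β y = α (g y) := by
  obtain h0 | h1 := zmod_two_eq_zero_or_one (Q x)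
  · by_cases hxz : ω x = 0
    · refine ⟨1, one_mem G, fun y => ?_⟩
      have := LinearMap.congr_fun hx y
      rw [hxz] at this
      exact (CharTwo.add_eq_zero.mp this.symm).symm
    obtain ⟨y₀, hly, hαy⟩ : ∃ y, ω x y = 0 ∧ α y ≠ 0 := by
      by_contra! hcon
      obtain ⟨z, hz⟩ : ∃ z, ω x z ≠ 0 := by
        by_contra! hcon
        exact hxz (LinearMap.ext hcon)
      replace hz := (zmod_two_eq_zero_or_one _).resolve_left hz
      have hα' : ∀ y, α y = α z * ω x y := fun y => by
        have := hcon (y + ω x y • z) (by simp [hz, CharTwo.add_self_eq_zero])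
        rw [map_add, map_smul, smul_eq_mul, mul_comm] at this
        exact CharTwo.add_eq_zero.mp this
      obtain hz' | hz' := zmod_two_eq_zero_or_one (α z)
      · exact hα (LinearMap.ext fun y => by rw [hα', hz', zero_mul]; rfl)
      · refine hβ (LinearMap.ext fun y => ?_)
        have h1 := LinearMap.congr_fun hx y
        rw [LinearMap.add_apply, hα' y, hz', one_mul] at h1
        exact left_eq_add.mp h1
    obtain ⟨y, hQy, hαy, hly⟩ := h.exists_quad_eq_one α (ω x) y₀
      ((zmod_two_eq_zero_or_one _).resolve_left hαy) hly
    obtain ⟨g, hg, hgy⟩ := hG y hQy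
    obtain ⟨k, hk, hkz⟩ := hG (x + y) (by rw [h.map_add, h0, hQy, hly]; decide)
    refine ⟨g * k, mul_mem hg hk, fun z => ?_⟩
    have h1 : ∀ z, (α + ω y) z = α (g z) :=
      comp_transvection h.alt (by
        rw [← add_assoc]; ext z; simp [CharTwo.add_self_eq_zero]) hαy hgy
    rw [Equiv.Perm.mul_apply, ← h1]
    refine comp_transvection h.alt ?_ ?_ hkz z
    · rw [map_add, hx]; abel
    · rw [LinearMap.add_apply, map_add, map_add, h.alt, ← hQ, h0, hαy, h.swap, hly]; decide
  · obtain ⟨g, hg, hgx⟩ := hG x h1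
    exact ⟨g, hg, comp_transvection h.alt hx (hQ ▸ h1) hgx⟩

end

/-- for `K = 𝔽₂` and `S` a basis of `X` of orthogonal type,
two nonzero `α, β ∈ X*` are in the same `Tr(S)*`-orbit iff there is an `x ∈ X`
with `ω(x) = α + β` and `Q_S(x) = α(x)`. -/
theorem stmt1 {X : Type*} [AddCommGroup X] [Module (ZMod 2) X]
    [FiniteDimensional (ZMod 2) X]
    (ω : X →ₗ[ZMod 2] X →ₗ[ZMod 2] ZMod 2) (halt : ∀ x, ω x x = 0)
    (S : Set X) (hind : LinearIndependent (ZMod 2) ((↑) : S → X))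
    (hspan : Submodule.span (ZMod 2) S = ⊤)
    (horth : IsOrthogonalType ω S)
    (Q : X → ZMod 2) (hQS : ∀ s ∈ S, Q s = 1)
    (hQpol : ∀ x y, Q (x + y) + Q x + Q y = ω x y)
    (α β : Module.Dual (ZMod 2) X) (hα : α ≠ 0) (hβ : β ≠ 0) :
    (∃ g ∈ transvectionGroup ω S, ∀ x, β x = α (g x)) ↔
      ∃ x, ω x = α + β ∧ Q x = α x := by
  have h : IsPolarized ω Q := ⟨halt, hQpol⟩
  constructor
  · rintro ⟨g, hg, hβg⟩
    obtain ⟨e, he, heα⟩ := exists_of_mem_transvectionGroup h hQS hg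
    obtain ⟨x, hx, hQx⟩ := heα α
    refine ⟨x, ?_, hQx⟩
    rw [hx]
    ext y
    simp [hβg, he]
  · rintro ⟨x, hx, hQx⟩
    obtain ⟨S', hS', htree, f, hf, hadj⟩ := horth
    obtain ⟨hspan', hQS', hsub⟩ := tEquiv_invariants h hspan hQS hS'
    have hE6 : IsE6Config ω Q fun i => (f i : X) := by
      refine { h with gram := fun i j => ?_, quad := fun i => hQS' _ (f i).2 }
      have hij := (hadj i j).trans (e6Graph_adj_iff i j)
      rw [transGraph, SimpleGraph.fromRel_adj, h.swap (f j : X), or_self] at hij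
      by_cases hne : i = j
      · subst hne
        rw [halt]
        fin_cases i <;> rfl
      · rw [and_iff_right (hf.ne hne)] at hij
        obtain h0 | h0 := zmod_two_eq_zero_or_one (ω (f i) (f j)) <;>
          obtain h1 | h1 := zmod_two_eq_zero_or_one (e6Gram i j) <;> simp_all
    exact exists_mem_transvectionGroup hE6 (fun y hy => hE6.mem_of_quad_eq_one hspan' hQS'
      (fun i => (f i).2) htree.1 hsub
      (fun u hu v hv => add_mem_transvectionVectors halt hu hv)
      (fun u => mem_transvectionVectors_of_form_eq_zero halt _) hy) hα hβ hx hQx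
end

section
/- Suppose K = F₂. Let S be a basis of X such that G(S) is connected and S has at least two elements, and let s ∈ S. If S \ {s} is a nice and connecting basis of its span Span(S \ {s}) (with respect to the restriction of ω), then S is a nice and connecting basis of X. -/
/-- Affine transvections `T^{α(s)}_{s,k} : x ↦ x + k(ω(x,s) + α(s))·s`. -/
def affTransvectionSet {K X : Type*} [Field K] [AddCommGroup X] [Module K X]
    (ω : X →ₗ[K] X →ₗ[K] K) (S : Set X) (α : X → K) : Set (Equiv.Perm X) :=
  {f | ∃ s ∈ S, ∃ k : K, k ≠ 0 ∧ ∀ x, f x = x + (k * (ω x s + α s)) • s}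

/-- The affine transvection group `Tr^α(S)`. -/
def affTransvectionGroup {K X : Type*} [Field K] [AddCommGroup X] [Module K X]
    (ω : X →ₗ[K] X →ₗ[K] K) (S : Set X) (α : X → K) : Subgroup (Equiv.Perm X) :=
  Subgroup.closure (affTransvectionSet ω S α)

/-- A basis `S` is *nice* if for every `χ ∈ 𝔽₂` and all `α, β ∈ X*` there is
an `x ∈ X` with `(Q_S + α)(x) = (Q_S + β)(x) = χ` and `ω(x) ∉ {α, β}`. -/
def IsNice {X : Type*} [AddCommGroup X] [Module (ZMod 2) X]
    (ω : X →ₗ[ZMod 2] X →ₗ[ZMod 2] ZMod 2) (S : Set X) : Prop :=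
  ∀ Q : X → ZMod 2, (∀ s ∈ S, Q s = 1) →
    (∀ x y, Q (x + y) + Q x + Q y = ω x y) →
    ∀ χ : ZMod 2, ∀ α β : Module.Dual (ZMod 2) X,
      ∃ x, Q x + α x = χ ∧ Q x + β x = χ ∧ ω x ≠ α ∧ ω x ≠ β

/-- A basis `S` is *connecting* if for every `α ∈ X*`, two points of `X` not
fixed by `Tr^α(S)` are in the same `Tr^α(S)`-orbit iff they have the same
`(Q_S + α)`-value. -/
def IsConnecting {X : Type*} [AddCommGroup X] [Module (ZMod 2) X]
    (ω : X →ₗ[ZMod 2] X →ₗ[ZMod 2] ZMod 2) (S : Set X) : Prop :=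
  ∀ Q : X → ZMod 2, (∀ s ∈ S, Q s = 1) →
    (∀ x y, Q (x + y) + Q x + Q y = ω x y) →
    ∀ α : Module.Dual (ZMod 2) X, ∀ x y : X,
      (∃ g ∈ affTransvectionGroup ω S ⇑α, g x ≠ x) →
      (∃ g ∈ affTransvectionGroup ω S ⇑α, g y ≠ y) →
      ((∃ g ∈ affTransvectionGroup ω S ⇑α, g x = y) ↔ Q x + α x = Q y + α y)

section AffineTransvections

variable {X : Type*} [AddCommGroup X] [Module (ZMod 2) X]
  {ω : X →ₗ[ZMod 2] X →ₗ[ZMod 2] ZMod 2}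

theorem ZMod.eq_one_of_ne_zero_two {k : ZMod 2} (hk : k ≠ 0) : k = 1 := by
  revert k; decide

theorem add_self_eq_zero_of_zmod_two (x : X) : x + x = 0 := by
  rw [← two_smul (ZMod 2) x, show (2 : ZMod 2) = 0 from rfl, zero_smul]

theorem alternating_symm_of_zmod_two (halt : ∀ x, ω x x = 0) (x y : X) : ω x y = ω y x := by
  have h := halt (x + y)
  simp only [map_add, LinearMap.add_apply, halt, zero_add, add_zero] at h
  generalize ω x y = a at h ⊢
  generalize ω y x = b at h ⊢
  revert a b; decide

/-- The affine transvection `x ↦ x + (ω(x,s) + a)·s` over `𝔽₂`, as a permutation. -/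
def affTransvection (halt : ∀ x, ω x x = 0) (s : X) (a : ZMod 2) : Equiv.Perm X :=
  Function.Involutive.toPerm (fun x => x + (ω x s + a) • s) fun x => by
    simp [halt, add_assoc, add_self_eq_zero_of_zmod_two]

theorem affTransvection_apply (halt : ∀ x, ω x x = 0) (s : X) (a : ZMod 2) (x : X) :
    affTransvection halt s a x = x + (ω x s + a) • s := rfl

theorem affTransvection_mem (halt : ∀ x, ω x x = 0) {S : Set X} {s : X} (hs : s ∈ S)
    (α : X → ZMod 2) : affTransvection halt s (α s) ∈ affTransvectionGroup ω S α :=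
  Subgroup.subset_closure ⟨s, hs, 1, one_ne_zero, fun x => by
    rw [affTransvection_apply, one_mul]⟩

theorem exists_mem_affTransvectionGroup_apply_ne (halt : ∀ x, ω x x = 0) {S : Set X} {s : X}
    (hs : s ∈ S) {α : Module.Dual (ZMod 2) X} {x : X} (hx : ω x s + α s ≠ 0) :
    ∃ g ∈ affTransvectionGroup ω S α, g x ≠ x := by
  refine ⟨_, affTransvection_mem halt hs α, fun h => ?_⟩
  rw [affTransvection_apply, ZMod.eq_one_of_ne_zero_two hx, one_smul, add_eq_left] at h
  exact hx (by simp [h])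

theorem exists_ne_zero_of_apply_ne {S : Set X} {α : X → ZMod 2} {x : X}
    (hx : ∃ g ∈ affTransvectionGroup ω S α, g x ≠ x) : ∃ s ∈ S, ω x s + α s ≠ 0 := by
  by_contra! h
  obtain ⟨g, hg, hgx⟩ := hx
  suffices affTransvectionGroup ω S α ≤ MulAction.stabilizer (Equiv.Perm X) x from
    hgx (this hg)
  refine (Subgroup.closure_le _).2 ?_
  rintro f ⟨s, hs, k, -, hf⟩
  change f x = x
  simp [hf, h s hs]

theorem quadratic_add_apply_eq {S : Set X} {Q : X → ZMod 2} (hQ : ∀ s ∈ S, Q s = 1)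
    (hQω : ∀ x y, Q (x + y) + Q x + Q y = ω x y) (α : Module.Dual (ZMod 2) X)
    {g : Equiv.Perm X} (hg : g ∈ affTransvectionGroup ω S α) (x : X) :
    Q (g x) + α (g x) = Q x + α x := by
  induction hg using Subgroup.closure_induction generalizing x with
  | mem f hf =>
    obtain ⟨s, hs, k, hk, hf⟩ := hf
    rw [hf, ZMod.eq_one_of_ne_zero_two hk, one_mul]
    by_cases hc : ω x s + α s = 0
    · rw [hc, zero_smul, add_zero]
    · rw [ZMod.eq_one_of_ne_zero_two hc, one_smul, map_add]
      have h := hQω x s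
      rw [hQ s hs] at h
      generalize Q (x + s) = a at h ⊢
      generalize Q x = b at h ⊢
      generalize α x = c
      generalize α s = d at hc ⊢
      generalize ω x s = e at h hc
      revert a b c d e; decide
  | one => rfl
  | mul f g _ _ hf hg => rw [Equiv.Perm.mul_apply, hf, hg]
  | inv f _ hf => simpa using (hf (f⁻¹ x)).symm

/-- An element of the affine transvection group of a subset of a subspace `Y`, with respect to the
functional `α + ω(t)`, is induced on the coset `Y + t` by one of the ambient space. -/
theorem exists_mem_affTransvectionGroup_coset (halt : ∀ x, ω x x = 0) {S S' : Set X} (hS : S' ⊆ S)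
    (Y : Submodule (ZMod 2) X) (α : Module.Dual (ZMod 2) X) (t : X) {g : Equiv.Perm Y}
    (hg : g ∈ affTransvectionGroup (ω.compl₁₂ Y.subtype Y.subtype) {y : Y | (y : X) ∈ S'}
      ((α + ω t) ∘ₗ Y.subtype)) :
    ∃ h ∈ affTransvectionGroup ω S α, ∀ y : Y, h (y + t) = g y + t := by
  induction hg using Subgroup.closure_induction with
  | mem f hf =>
    obtain ⟨s, hs, k, hk, hf⟩ := hf
    refine ⟨_, affTransvection_mem halt (hS hs) α, fun y => ?_⟩
    rw [affTransvection_apply, hf, ZMod.eq_one_of_ne_zero_two hk]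
    simp only [map_add, LinearMap.add_apply, LinearMap.compl₁₂_apply, Submodule.subtype_apply,
      LinearMap.comp_apply, one_mul, Submodule.coe_add, Submodule.coe_smul]
    module
  | one => exact ⟨1, one_mem _, fun y => rfl⟩
  | mul f g _ _ hf hg =>
    obtain ⟨f', hf', hf⟩ := hf
    obtain ⟨g', hg', hg⟩ := hg
    exact ⟨f' * g', mul_mem hf' hg', fun y => by
      rw [Equiv.Perm.mul_apply, hg, hf, Equiv.Perm.mul_apply]⟩
  | inv f _ hf =>
    obtain ⟨f', hf', hf⟩ := hf
    refine ⟨f'⁻¹, inv_mem hf', fun y => ?_⟩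
    rw [Equiv.Perm.inv_eq_iff_eq, hf]
    simp

theorem IsConnecting.exists_apply_eq_of_sub_mem (halt : ∀ x, ω x x = 0) {S S' : Set X}
    (hS : S' ⊆ S) {Y : Submodule (ZMod 2) X} (hY : S' ⊆ Y)
    (h : IsConnecting (ω.compl₁₂ Y.subtype Y.subtype) {y : Y | (y : X) ∈ S'})
    {Q : X → ZMod 2} (hQ : ∀ s ∈ S, Q s = 1)
    (hQω : ∀ x y, Q (x + y) + Q x + Q y = ω x y) (α : Module.Dual (ZMod 2) X) {x y : X}
    (hxy : y - x ∈ Y) (hx : ∃ a ∈ S', ω x a + α a ≠ 0) (hy : ∃ a ∈ S', ω y a + α a ≠ 0)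
    (hval : Q x + α x = Q y + α y) : ∃ g ∈ affTransvectionGroup ω S α, g x = y := by
  have halt' : ∀ z, ω.compl₁₂ Y.subtype Y.subtype z z = 0 := fun z => halt z
  obtain ⟨a, ha, hxa⟩ := hx
  obtain ⟨b, hb, hyb⟩ := hy
  have key := h (fun z => Q z) (fun z hz => hQ z (hS hz)) (fun z w => hQω z w)
    ((α + ω x) ∘ₗ Y.subtype) 0 ⟨y - x, hxy⟩
    (exists_mem_affTransvectionGroup_apply_ne halt' (s := ⟨a, hY ha⟩) ha
      (by simpa [add_comm] using hxa))
    (exists_mem_affTransvectionGroup_apply_ne halt' (s := ⟨b, hY hb⟩) hb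
      (by
        simp only [map_sub, LinearMap.sub_apply, LinearMap.add_apply, LinearMap.compl₁₂_apply,
          Submodule.subtype_apply, LinearMap.comp_apply]
        convert hyb using 1
        ring))
  obtain ⟨g, hg, hgx⟩ := key.2 (by
    have h0 := hQω 0 0
    have h1 := hQω (y - x) x
    rw [sub_add_cancel, alternating_symm_of_zmod_two halt] at h1
    simp only [LinearMap.comp_apply, Submodule.subtype_apply, Submodule.coe_zero, map_zero,
      LinearMap.add_apply, add_zero] at h0 ⊢
    rw [← h1, map_sub]
    generalize Q 0 = q at h0 ⊢
    generalize Q (y - x) = r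
    generalize Q x = a at hval ⊢
    generalize Q y = b at hval ⊢
    generalize α x = c at hval ⊢
    generalize α y = d at hval ⊢
    clear * - h0 hval
    revert q r a b c d; decide)
  obtain ⟨f, hf, hfg⟩ := exists_mem_affTransvectionGroup_coset halt hS Y α x hg
  exact ⟨f, hf, by simpa [hgx] using hfg 0⟩

theorem exists_mem_add_ne_zero_of_comp_ne {S' : Set X}
    {φ α : Module.Dual (ZMod 2) X} (h : φ ∘ₗ (Submodule.span (ZMod 2) S').subtype ≠
      α ∘ₗ (Submodule.span (ZMod 2) S').subtype) : ∃ a ∈ S', φ a + α a ≠ 0 := by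
  by_contra! h'
  refine h (LinearMap.ext fun y => LinearMap.eqOn_span (s := S') (fun a ha => ?_) y.2)
  exact CharTwo.add_eq_zero.1 (h' a ha)

theorem IsNice.of_subset {S S' : Set X} (hS : S' ⊆ S) {Y : Submodule (ZMod 2) X}
    (h : IsNice (ω.compl₁₂ Y.subtype Y.subtype) {y : Y | (y : X) ∈ S'}) : IsNice ω S := by
  intro Q hQ hQω χ α β
  obtain ⟨x, hxα, hxβ, hα, hβ⟩ := h (fun z => Q z) (fun z hz => hQ z (hS hz))
    (fun z w => hQω z w) χ (α ∘ₗ Y.subtype) (β ∘ₗ Y.subtype)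
  refine ⟨x, hxα, hxβ, fun e => hα ?_, fun e => hβ ?_⟩ <;> rw [← e] <;> rfl

theorem IsNice.exists_linking (halt : ∀ x, ω x x = 0) {S' : Set X} {s v : X}
    (h : IsNice (ω.compl₁₂ (Submodule.span (ZMod 2) S').subtype
      (Submodule.span (ZMod 2) S').subtype)
      {y : Submodule.span (ZMod 2) S' | (y : X) ∈ S'})
    {Q : X → ZMod 2} (hQ : ∀ a ∈ S', Q a = 1)
    (hQω : ∀ x y, Q (x + y) + Q x + Q y = ω x y) (α : Module.Dual (ZMod 2) X)
    (hv : v ∈ Submodule.span (ZMod 2) S') (hvs : ω v s + α s = 1) (χ : ZMod 2) :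
    ∃ u ∈ Submodule.span (ZMod 2) S', Q u + α u = χ ∧ ω u s + α s = 1 ∧
      (∃ a ∈ S', ω u a + α a ≠ 0) ∧ ∃ a ∈ S', ω (u + s) a + α a ≠ 0 := by
  set Y := Submodule.span (ZMod 2) S'
  obtain ⟨x, hxα, hxβ, hα, hβ⟩ := h (fun z => Q z) (fun z hz => hQ z hz)
    (fun z w => hQω z w)
    (χ + Q v + α v) ((α + ω v) ∘ₗ Y.subtype) ((α + ω s + ω v) ∘ₗ Y.subtype)
  simp only [LinearMap.comp_apply, Submodule.subtype_apply, LinearMap.add_apply] at hxα hxβ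
  have hsx : ω x s = 0 := by
    rw [alternating_symm_of_zmod_two halt]
    linear_combination hxβ - hxα
  refine ⟨x + v, Y.add_mem x.2 hv, ?_, ?_, ?_, ?_⟩
  · have h1 := hQω x v
    rw [alternating_symm_of_zmod_two halt] at hxα
    rw [← h1] at hxα
    rw [map_add]
    generalize Q (x + v) = a at hxα ⊢
    generalize Q x = b at hxα
    generalize Q v = c at hxα
    generalize α x = d at hxα ⊢
    generalize α v = e at hxα ⊢
    clear * - hxα
    revert a b c d e χ; decide
  · rw [map_add, LinearMap.add_apply, hsx, zero_add, hvs]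
  · refine exists_mem_add_ne_zero_of_comp_ne fun e => hα (LinearMap.ext fun y => ?_)
    have := LinearMap.congr_fun e y
    simp only [map_add, LinearMap.comp_apply, Submodule.subtype_apply, LinearMap.add_apply,
      LinearMap.compl₁₂_apply] at this ⊢
    rw [← this, add_assoc, CharTwo.add_self_eq_zero, add_zero]
  · refine exists_mem_add_ne_zero_of_comp_ne fun e => hβ (LinearMap.ext fun y => ?_)
    have := LinearMap.congr_fun e y
    simp only [map_add, LinearMap.comp_apply, Submodule.subtype_apply, LinearMap.add_apply,
      LinearMap.compl₁₂_apply] at this ⊢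
    rw [← this]
    linear_combination -CharTwo.add_self_eq_zero (ω v y) - CharTwo.add_self_eq_zero (ω s y)

theorem exists_adjacent_of_connected (halt : ∀ x, ω x x = 0) {S : Set X}
    (hconn : (transGraph ω S).Connected) (hcard : S.Nontrivial) {s : X} (hs : s ∈ S) :
    ∃ v ∈ S \ {s}, ω v s = 1 := by
  have : Nontrivial S := hcard.coe_sort
  obtain ⟨⟨v, hv⟩, hne, h⟩ := hconn.preconnected.exists_adj_of_nontrivial ⟨s, hs⟩
  refine ⟨v, ⟨hv, fun e => hne (Subtype.ext (Eq.symm e))⟩, ZMod.eq_one_of_ne_zero_two ?_⟩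
  rw [alternating_symm_of_zmod_two halt v s] at *
  exact h.elim id fun h => by rwa [alternating_symm_of_zmod_two halt s v]

theorem mem_or_add_mem_span_diff {S : Set X} (hspan : Submodule.span (ZMod 2) S = ⊤) {s : X}
    (hs : s ∈ S) (x : X) :
    x ∈ Submodule.span (ZMod 2) (S \ {s}) ∨ x + s ∈ Submodule.span (ZMod 2) (S \ {s}) := by
  have hx : x ∈ Submodule.span (ZMod 2) (insert s (S \ {s})) := by
    rw [Set.insert_sdiff_self_of_mem hs, hspan]; trivial
  obtain ⟨k, z, hz, rfl⟩ := Submodule.mem_span_insert.1 hx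
  by_cases hk : k = 0
  · left; simpa [hk] using hz
  · right
    rw [ZMod.eq_one_of_ne_zero_two hk, one_smul, add_right_comm, add_self_eq_zero_of_zmod_two,
      zero_add]
    exact hz

theorem IsConnecting.of_diff_singleton (halt : ∀ x, ω x x = 0) {S : Set X}
    (hspan : Submodule.span (ZMod 2) S = ⊤) {s v : X} (hs : s ∈ S) (hv : v ∈ S \ {s})
    (hvs : ω v s = 1)
    (hnice : IsNice (ω.compl₁₂ (Submodule.span (ZMod 2) (S \ {s})).subtype
        (Submodule.span (ZMod 2) (S \ {s})).subtype)
      {y : Submodule.span (ZMod 2) (S \ {s}) | (y : X) ∈ S \ {s}})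
    (hconnecting : IsConnecting (ω.compl₁₂ (Submodule.span (ZMod 2) (S \ {s})).subtype
        (Submodule.span (ZMod 2) (S \ {s})).subtype)
      {y : Submodule.span (ZMod 2) (S \ {s}) | (y : X) ∈ S \ {s}}) :
    IsConnecting ω S := by
  intro Q hQ hQω α x y hx hy
  refine ⟨fun ⟨g, hg, hgx⟩ => hgx ▸ (quadratic_add_apply_eq hQ hQω α hg x).symm, fun hval => ?_⟩
  have hsub : S \ {s} ⊆ S := Set.sdiff_subset
  have hSY := Submodule.subset_span (R := ZMod 2) (s := S \ {s})
  obtain ⟨w, hw, hws⟩ : ∃ w ∈ Submodule.span (ZMod 2) (S \ {s}), ω w s + α s = 1 := by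
    by_cases hα : α s = 0
    · exact ⟨v, hSY hv, by rw [hvs, hα, add_zero]⟩
    · exact ⟨0, zero_mem _, by simp [ZMod.eq_one_of_ne_zero_two hα]⟩
  obtain ⟨u, hu, huχ, hus, hunf, husnf⟩ := hnice.exists_linking halt
    (fun a ha => hQ a (hsub ha)) hQω α hw hws (Q x + α x)
  have hTs := affTransvection_mem halt hs α
  have hTu : affTransvection halt s (α s) u = u + s := by
    rw [affTransvection_apply, hus, one_smul]
  have toU' : ∀ z, Q z + α z = Q x + α x → (∃ a ∈ S \ {s}, ω z a + α a ≠ 0) →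
      ∃ g ∈ affTransvectionGroup ω S α, g z = u := by
    intro z hz hznf
    rcases mem_or_add_mem_span_diff hspan hs z with hzY | hzY
    · exact hconnecting.exists_apply_eq_of_sub_mem halt hsub hSY hQ hQω α
        (sub_mem hu hzY) hznf hunf (hz.trans huχ.symm)
    · have hsval := quadratic_add_apply_eq hQ hQω α hTs u
      rw [hTu] at hsval
      obtain ⟨g, hg, hgz⟩ := hconnecting.exists_apply_eq_of_sub_mem halt hsub hSY hQ hQω α
        (x := z) (y := u + s)
        (by
          have : u + s - z = u - (z + s) + (s + s) := by abel
          rw [this, add_self_eq_zero_of_zmod_two, add_zero]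
          exact sub_mem hu hzY)
        hznf husnf (hz.trans (huχ.symm.trans hsval.symm))
      exact ⟨_, mul_mem (inv_mem hTs) hg, by
        rw [Equiv.Perm.mul_apply, hgz, Equiv.Perm.inv_eq_iff_eq, hTu]⟩
  have toU : ∀ z, Q z + α z = Q x + α x → (∃ g ∈ affTransvectionGroup ω S α, g z ≠ z) →
      ∃ g ∈ affTransvectionGroup ω S α, g z = u := by
    intro z hz hznf
    by_cases hz' : ∃ a ∈ S \ {s}, ω z a + α a ≠ 0
    · exact toU' z hz hz'
    obtain ⟨a, ha, hza⟩ := exists_ne_zero_of_apply_ne hznf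
    have has : a = s := by
      by_contra hne
      exact hz' ⟨a, ⟨ha, hne⟩, hza⟩
    subst has
    have hTz : affTransvection halt a (α a) z = z + a := by
      rw [affTransvection_apply, ZMod.eq_one_of_ne_zero_two hza, one_smul]
    have hval' := quadratic_add_apply_eq hQ hQω α hTs z
    push Not at hz'
    obtain ⟨g, hg, hgz⟩ := toU' _ (hval'.trans hz) ⟨v, hv, by
      rw [hTz, map_add, LinearMap.add_apply, add_right_comm, hz' v hv,
        alternating_symm_of_zmod_two halt, hvs]
      decide⟩
    exact ⟨_, mul_mem hg hTs, hgz⟩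
  obtain ⟨g, hg, hgx⟩ := toU x rfl hx
  obtain ⟨f, hf, hfy⟩ := toU y hval.symm hy
  exact ⟨f⁻¹ * g, mul_mem (inv_mem hf) hg, by
    rw [Equiv.Perm.mul_apply, hgx, Equiv.Perm.inv_eq_iff_eq, hfy]⟩

end AffineTransvections

/-- over `K = 𝔽₂`, let `S` be a basis of `X` with `G(S)`
connected and at least two elements, and `s ∈ S`.  If `S \ {s}` is a nice and
connecting basis of its span (w.r.t. the restricted form), then `S` is a nice
and connecting basis of `X`. -/
theorem stmt15 {X : Type*} [AddCommGroup X] [Module (ZMod 2) X]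
    [FiniteDimensional (ZMod 2) X]
    (ω : X →ₗ[ZMod 2] X →ₗ[ZMod 2] ZMod 2) (halt : ∀ x, ω x x = 0)
    (S : Set X) (hind : LinearIndependent (ZMod 2) ((↑) : S → X))
    (hspan : Submodule.span (ZMod 2) S = ⊤)
    (hconn : (transGraph ω S).Connected)
    (hcard : S.Nontrivial) (s : X) (hs : s ∈ S)
    (hnice : IsNice
      (ω.compl₁₂ (Submodule.span (ZMod 2) (S \ {s})).subtype
        (Submodule.span (ZMod 2) (S \ {s})).subtype)
      {y : Submodule.span (ZMod 2) (S \ {s}) | (y : X) ∈ S \ {s}})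
    (hconnecting : IsConnecting
      (ω.compl₁₂ (Submodule.span (ZMod 2) (S \ {s})).subtype
        (Submodule.span (ZMod 2) (S \ {s})).subtype)
      {y : Submodule.span (ZMod 2) (S \ {s}) | (y : X) ∈ S \ {s}}) :
    IsNice ω S ∧ IsConnecting ω S := by
  obtain ⟨v, hv, hvs⟩ := exists_adjacent_of_connected halt hconn hcard hs
  exact ⟨hnice.of_subset Set.sdiff_subset,
    IsConnecting.of_diff_singleton halt hspan hs hv hvs hnice hconnecting⟩
end
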